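/- Fix x22, y22 ∈ F with (x22, y22) ≠ (0, 0). For a, b ∈ F set M(a,b) := T(q)((0,0; a,x22), (0,0; b,y22)) and D(a,b) := T(q)((0,0; a,0), (0,0; b,0)). Let the point set be Π := {M(a,b) : a, b ∈ F} ∪ {D(a,b) : (a,b) ∈ F², (a,b) ≠ (0,0)}, and let the line set be 𝕃 := {ℓ : ℓ is a free cyclic submodule of ²T(q) containing M(a,b) for some a, b ∈ F} ∪ {N}, where N := T(q)((x22,0; y22,0), (y22,0; δ,0)) with δ = 1 if y22 = 0 and δ = 0 otherwise; say a point P ∈ Π lies on a line ℓ ∈ 𝕃 when P ⊆ ℓ. Then (Π, 𝕃) is a projective plane of order q; explicitly: any two distinct points of Π are contained in exactly one line of 𝕃; for any two distinct lines of 𝕃 there is exactly one point of Π contained in both; there exist four points of Π no three of which are contained in one common line; and every line of 𝕃 contains exactly q+1 points of Π. -/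

import Mathlib

open Matrix

/-- `Mat n F` is the type of `n × n` matrices over `F`. -/
abbrev Mat (n : ℕ) (F : Type) : Type := Matrix (Fin n) (Fin n) F

/-- A matrix is lower triangular (i.e. belongs to the ring `T_n(q)`)
if all entries above the diagonal vanish. -/
def LowerTri {n : ℕ} {F : Type} [Zero F] (X : Mat n F) : Prop :=
  ∀ i j : Fin n, i < j → X i j = 0

/-- The cyclic left submodule `T_n(q)(X,Y)` of `²T_n(q)` generated by the pair `(X,Y)`. -/
def cyc {n : ℕ} {F : Type} [Field F] (X Y : Mat n F) : Set (Mat n F × Mat n F) :=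
  {p | ∃ A : Mat n F, LowerTri A ∧ p = (A * X, A * Y)}

/-- The pair `(X,Y)` generates a *free* cyclic submodule:
`A • (X,Y) = (0,0)` with `A ∈ T_n(q)` forces `A = 0`. -/
def IsFreePair {n : ℕ} {F : Type} [Field F] (X Y : Mat n F) : Prop :=
  ∀ A : Mat n F, LowerTri A → A * X = 0 → A * Y = 0 → A = 0

/-- A pair `(X,Y)` is unimodular if for every index `i` one of the `i`-th
diagonal entries of `X`, `Y` is nonzero. -/
def Unimodular {n : ℕ} {F : Type} [Field F] (X Y : Mat n F) : Prop :=
  ∀ i : Fin n, X i i ≠ 0 ∨ Y i i ≠ 0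

/-- `M` is a free cyclic submodule of `²T_n(q)`. -/
def IsFreeCyc {n : ℕ} {F : Type} [Field F] (M : Set (Mat n F × Mat n F)) : Prop :=
  ∃ X Y : Mat n F, LowerTri X ∧ LowerTri Y ∧ IsFreePair X Y ∧ M = cyc X Y

/-- `M` is a free cyclic submodule of `²T_n(q)` generated by a non-unimodular pair. -/
def IsNonUnimodFreeCyc {n : ℕ} {F : Type} [Field F] (M : Set (Mat n F × Mat n F)) : Prop :=
  ∃ X Y : Mat n F, LowerTri X ∧ LowerTri Y ∧ ¬ Unimodular X Y ∧ IsFreePair X Y ∧ M = cyc X Y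

/-- The point `M(a,b) = T(q)((0,0; a,x22),(0,0; b,y22))` of the affine plane. -/
def Mpt {F : Type} [Field F] (x22 y22 a b : F) : Set (Mat 2 F × Mat 2 F) :=
  cyc !![0, 0; a, x22] !![0, 0; b, y22]

/-- The point at infinity `D(a,b) = T(q)((0,0; a,0),(0,0; b,0))`. -/
def Dpt {F : Type} [Field F] (a b : F) : Set (Mat 2 F × Mat 2 F) :=
  cyc !![0, 0; a, 0] !![0, 0; b, 0]

/-- The point set `Π` of the projective closure. -/
def PtSet {F : Type} [Field F] (x22 y22 : F) : Set (Set (Mat 2 F × Mat 2 F)) :=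
  {P | ∃ a b : F, P = Mpt x22 y22 a b} ∪
  {P | ∃ a b : F, (a, b) ≠ (0, 0) ∧ P = Dpt a b}

/-- The line at infinity `N`. -/
def Nline {F : Type} [Field F] [DecidableEq F] (x22 y22 : F) : Set (Mat 2 F × Mat 2 F) :=
  cyc !![x22, 0; y22, 0] !![y22, 0; (if y22 = 0 then 1 else 0), 0]

/-- The line set `𝕃` of the projective closure. -/
def LnSet {F : Type} [Field F] [DecidableEq F] (x22 y22 : F) :
    Set (Set (Mat 2 F × Mat 2 F)) :=
  {l | IsFreeCyc l ∧ ∃ a b : F, Mpt x22 y22 a b ⊆ l} ∪ {Nline x22 y22}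

open Configuration LinearAlgebra.Projectivization

section Coordinates

variable {F : Type} [Field F]

lemma mem_cyc_iff {X Y : Mat 2 F} (hX : LowerTri X) (hY : LowerTri Y) (p : Mat 2 F × Mat 2 F) :
    p ∈ cyc X Y ↔ ∃ t r s : F,
      p = (!![t * X 0 0, 0; r * X 0 0 + s * X 1 0, s * X 1 1],
        !![t * Y 0 0, 0; r * Y 0 0 + s * Y 1 0, s * Y 1 1]) := by
  have hX' : X 0 1 = 0 := hX 0 1 (by decide)
  have hY' : Y 0 1 = 0 := hY 0 1 (by decide)
  constructor
  · rintro ⟨A, hA, rfl⟩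
    have hA' : A 0 1 = 0 := hA 0 1 (by decide)
    refine ⟨A 0 0, A 1 0, A 1 1, Prod.ext ?_ ?_⟩ <;> ext i j <;> fin_cases i <;> fin_cases j <;>
      simp [Matrix.mul_apply, Fin.sum_univ_two, *]
  · rintro ⟨t, r, s, rfl⟩
    refine ⟨!![t, 0; r, s], ?_, Prod.ext ?_ ?_⟩
    · intro i j hij
      fin_cases i <;> fin_cases j <;> simp_all
    all_goals
      ext i j
      fin_cases i <;> fin_cases j <;> simp [Matrix.mul_apply, Fin.sum_univ_two, *]

lemma lowerTri_of (a b c : F) : LowerTri !![a, 0; b, c] := by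
  intro i j hij
  fin_cases i <;> fin_cases j <;> simp_all

lemma IsFreePair.zero_zero_ne {X Y : Mat 2 F} (hX : LowerTri X) (hY : LowerTri Y)
    (h : IsFreePair X Y) : X 0 0 ≠ 0 ∨ Y 0 0 ≠ 0 := by
  by_contra! hc
  have hX' : X 0 1 = 0 := hX 0 1 (by decide)
  have hY' : Y 0 1 = 0 := hY 0 1 (by decide)
  have h0 := h !![1, 0; 0, 0] (lowerTri_of _ _ _)
    (by ext i j; fin_cases i <;> fin_cases j <;> simp [Matrix.mul_apply, Fin.sum_univ_two, *])
    (by ext i j; fin_cases i <;> fin_cases j <;> simp [Matrix.mul_apply, Fin.sum_univ_two, *])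
  simpa using congr_fun (congr_fun h0 0) 0

lemma isFreePair_of {x y u₀ u₁ : F} (hxy : x ≠ 0 ∨ y ≠ 0) (hu : u₀ ≠ 0 ∨ u₁ ≠ 0) (a b : F) :
    IsFreePair !![u₀, 0; a, x] !![u₁, 0; b, y] := by
  intro A hA h0 h1
  have hA' : A 0 1 = 0 := hA 0 1 (by decide)
  simp only [← Matrix.ext_iff, Fin.forall_fin_two] at h0 h1
  simp [Matrix.mul_apply, Fin.sum_univ_two, hA'] at h0 h1
  ext i j
  fin_cases i <;> fin_cases j <;> simp <;> grind

/-- The point of the plane with homogeneous coordinates `v`. -/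
def pointOf (x y : F) (v : Fin 3 → F) : Set (Mat 2 F × Mat 2 F) :=
  cyc !![0, 0; v 0, v 2 * x] !![0, 0; v 1, v 2 * y]

lemma mem_pointOf {x y : F} {v : Fin 3 → F} {p : Mat 2 F × Mat 2 F} :
    p ∈ pointOf x y v ↔ ∃ s : F,
      p = (!![0, 0; s * v 0, s * (v 2 * x)], !![0, 0; s * v 1, s * (v 2 * y)]) := by
  rw [pointOf, mem_cyc_iff (lowerTri_of _ _ _) (lowerTri_of _ _ _)]
  simp

/-- The line of the plane with homogeneous coordinates `n`. -/
def lineOf [DecidableEq F] (x y : F) (n : Fin 3 → F) : Set (Mat 2 F × Mat 2 F) :=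
  {p | ∃ t s a b : F, n 0 * a + n 1 * b + n 2 * s = 0 ∧
    p = if n 0 = 0 ∧ n 1 = 0 then (!![t * x, 0; a, s * x], !![t * y, 0; b, s * y])
      else (!![t * -n 1, 0; a, s * x], !![t * n 0, 0; b, s * y])}

lemma pointOf_smul (x y : F) {c : F} (hc : c ≠ 0) (v : Fin 3 → F) :
    pointOf x y (c • v) = pointOf x y v := by
  ext p
  simp only [mem_pointOf, Pi.smul_apply, smul_eq_mul]
  constructor
  · rintro ⟨s, rfl⟩
    exact ⟨s * c, by simp only [mul_assoc]⟩
  · rintro ⟨s, rfl⟩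
    refine ⟨s / c, ?_⟩
    congr! 4 <;> field_simp

lemma exists_smul_eq_of_pointOf_eq {x y : F} (hxy : x ≠ 0 ∨ y ≠ 0) {v w : Fin 3 → F}
    (h : pointOf x y v = pointOf x y w) : ∃ s : F, s • w = v := by
  have hv := h.subset (mem_pointOf.2 ⟨1, rfl⟩)
  obtain ⟨s, hs⟩ := mem_pointOf.1 hv
  simp only [Prod.mk.injEq, ← Matrix.ext_iff, Fin.forall_fin_two] at hs
  simp at hs
  obtain ⟨⟨h0, hx⟩, h1, hy⟩ := hs
  refine ⟨s, ?_⟩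
  ext i
  fin_cases i
  · simpa using h0.symm
  · simpa using h1.symm
  · rcases hxy with hx0 | hy0
    · exact mul_right_cancel₀ hx0 (show s * w 2 * x = v 2 * x by linear_combination -hx)
    · exact mul_right_cancel₀ hy0 (show s * w 2 * y = v 2 * y by linear_combination -hy)

lemma ptSet_eq (x y : F) :
    PtSet x y = {P | ∃ v : Fin 3 → F, v ≠ 0 ∧ pointOf x y v = P} := by
  ext P
  constructor
  · rintro (⟨a, b, rfl⟩ | ⟨a, b, hab, rfl⟩)
    · exact ⟨![a, b, 1], fun h => by simpa using congr_fun h 2, by simp [pointOf, Mpt]⟩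
    · refine ⟨![a, b, 0], fun h => hab ?_, by simp [pointOf, Dpt]⟩
      simpa using And.intro (congr_fun h 0) (congr_fun h 1)
  · rintro ⟨v, hv, rfl⟩
    by_cases h2 : v 2 = 0
    · refine Or.inr ⟨v 0, v 1, fun h => hv ?_, by simp [pointOf, Dpt, h2]⟩
      rw [Prod.mk.injEq] at h
      ext i
      fin_cases i <;> simp [*]
    · refine Or.inl ⟨(v 2)⁻¹ * v 0, (v 2)⁻¹ * v 1, ?_⟩
      rw [← pointOf_smul x y (inv_ne_zero h2)]
      simp [pointOf, Mpt, h2]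

variable [DecidableEq F]

lemma pointOf_subset_lineOf {x y : F} (hxy : x ≠ 0 ∨ y ≠ 0) (v n : Fin 3 → F) :
    pointOf x y v ⊆ lineOf x y n ↔ v ⬝ᵥ n = 0 := by
  simp only [dotProduct, Fin.sum_univ_three]
  constructor
  · intro h
    obtain ⟨t, s, a, b, h0, hp⟩ := h (mem_pointOf.2 ⟨1, rfl⟩)
    have key : v 0 = a ∧ v 1 = b ∧ v 2 * x = s * x ∧ v 2 * y = s * y := by
      split_ifs at hp <;>
      · simp only [Prod.mk.injEq, ← Matrix.ext_iff, Fin.forall_fin_two] at hp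
        simp at hp
        tauto
    obtain ⟨rfl, rfl, hx, hy⟩ := key
    have : v 2 = s := hxy.elim (fun h => mul_right_cancel₀ h hx) (fun h => mul_right_cancel₀ h hy)
    subst this
    linear_combination h0
  · rintro h p hp
    obtain ⟨s, rfl⟩ := mem_pointOf.1 hp
    refine ⟨0, s * v 2, s * v 0, s * v 1, by linear_combination s * h, ?_⟩
    simp [mul_assoc]

lemma lineOf_smul (x y : F) {c : F} (hc : c ≠ 0) (n : Fin 3 → F) :
    lineOf x y (c • n) = lineOf x y n := by
  ext p
  simp only [lineOf, Set.mem_ofPred_eq, Pi.smul_apply, smul_eq_mul, mul_eq_zero, hc, false_or]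
  split_ifs
  · refine exists₄_congr fun t s a b => and_congr_left' ?_
    simp only [mul_assoc, ← mul_add, mul_eq_zero, hc, false_or]
  · constructor
    · rintro ⟨t, s, a, b, h, rfl⟩
      refine ⟨t * c, s, a, b, mul_left_cancel₀ hc (by linear_combination h), ?_⟩
      congr! 4 <;> ring
    · rintro ⟨t, s, a, b, h, rfl⟩
      refine ⟨t / c, s, a, b, by linear_combination c * h, ?_⟩
      congr! 4 <;> field_simp

lemma lineOf_eq_cyc {x y : F} {n : Fin 3 → F} (hn : ¬(n 0 = 0 ∧ n 1 = 0)) {a b : F}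
    (hab : n 0 * a + n 1 * b + n 2 = 0) :
    lineOf x y n = cyc !![-n 1, 0; a, x] !![n 0, 0; b, y] := by
  ext p
  rw [mem_cyc_iff (lowerTri_of _ _ _) (lowerTri_of _ _ _)]
  simp only [lineOf, hn, if_false, Set.mem_ofPred_eq]
  constructor
  · rintro ⟨t, s, c, d, h, rfl⟩
    obtain ⟨r, hr⟩ : ∃ r, c = r * -n 1 + s * a ∧ d = r * n 0 + s * b := by
      have key : n 0 * (c - s * a) + n 1 * (d - s * b) = 0 := by
        linear_combination h - s * hab
      by_cases h0 : n 0 = 0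
      · have h1 : n 1 ≠ 0 := fun h1 => hn ⟨h0, h1⟩
        refine ⟨-(c - s * a) / n 1, by field_simp; ring, ?_⟩
        have : d - s * b = 0 := by simpa [h0, h1] using key
        rw [h0]
        linear_combination this
      · refine ⟨(d - s * b) / n 0, ?_, by field_simp; ring⟩
        field_simp
        linear_combination key
    exact ⟨t, r, s, by simp [hr]⟩
  · rintro ⟨t, r, s, rfl⟩
    refine ⟨t, s, r * -n 1 + s * a, r * n 0 + s * b, by linear_combination s * hab, by simp⟩

lemma lineOf_eq_Nline {x y : F} (hxy : x ≠ 0 ∨ y ≠ 0) {n : Fin 3 → F} (hn : n 0 = 0 ∧ n 1 = 0)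
    (h2 : n 2 ≠ 0) : lineOf x y n = Nline x y := by
  ext p
  rw [Nline, mem_cyc_iff (lowerTri_of _ _ _) (lowerTri_of _ _ _)]
  simp only [lineOf, hn, Set.mem_ofPred_eq]
  constructor
  · rintro ⟨t, s, a, b, h, rfl⟩
    obtain rfl : s = 0 := by simpa [h2] using h
    by_cases hy : y = 0
    · have hx : x ≠ 0 := by simpa [hy] using hxy
      exact ⟨t, a / x, b, by simp [hx, hy]⟩
    · refine ⟨t, b / y, (a - b / y * x) / y, by simp [hy]⟩
  · rintro ⟨t, r, s, rfl⟩
    exact ⟨t, 0, r * x + s * y, r * y + s * (if y = 0 then 1 else 0), by ring, by simp⟩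

lemma cyc_eq_lineOf {x y : F} (hxy : x ≠ 0 ∨ y ≠ 0) {X Y : Mat 2 F} (hX : LowerTri X)
    (hY : LowerTri Y) (h : IsFreePair X Y) {a b : F} (hM : Mpt x y a b ⊆ cyc X Y) :
    cyc X Y = lineOf x y ![Y 0 0, -X 0 0, X 0 0 * b - Y 0 0 * a] := by
  have hu := h.zero_zero_ne hX hY
  rw [lineOf_eq_cyc (a := a) (b := b) (by simp; tauto) (by simp; ring)]
  have hmem : (!![0, 0; a, x], !![0, 0; b, y]) ∈ Mpt x y a b :=
    (mem_cyc_iff (lowerTri_of _ _ _) (lowerTri_of _ _ _) _).2 ⟨0, 0, 1, by simp⟩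
  obtain ⟨t, r, s, hp⟩ := (mem_cyc_iff hX hY _).1 (hM hmem)
  simp only [Prod.mk.injEq, ← Matrix.ext_iff, Fin.forall_fin_two] at hp
  simp at hp
  obtain ⟨⟨-, ha, hx⟩, -, hb, hy⟩ := hp
  have hs : s ≠ 0 := by
    rintro rfl
    simp_all
  ext p
  rw [mem_cyc_iff hX hY, mem_cyc_iff (lowerTri_of _ _ _) (lowerTri_of _ _ _)]
  simp [ha, hb, hx, hy]
  constructor
  · rintro ⟨t', r', s', rfl⟩
    refine ⟨t', r' - s' / s * r, s' / s, ?_⟩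
    congr! 5 <;> field_simp <;> ring
  · rintro ⟨t', r', s', rfl⟩
    refine ⟨t', r' + s' * r, s' * s, ?_⟩
    congr! 4 <;> ring_nf

lemma lnSet_eq {x y : F} (hxy : x ≠ 0 ∨ y ≠ 0) :
    LnSet x y = {l | ∃ n : Fin 3 → F, n ≠ 0 ∧ lineOf x y n = l} := by
  ext l
  constructor
  · rintro (⟨⟨X, Y, hX, hY, h, rfl⟩, a, b, hM⟩ | rfl)
    · refine ⟨_, fun h0 => ?_, (cyc_eq_lineOf hxy hX hY h hM).symm⟩
      have h1 := congr_fun h0 0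
      have h2 := congr_fun h0 1
      have := h.zero_zero_ne hX hY
      simp at h1 h2
      tauto
    · exact ⟨![0, 0, 1], fun h => by simpa using congr_fun h 2,
        lineOf_eq_Nline hxy (by simp) (by simp)⟩
  · rintro ⟨n, hn, rfl⟩
    by_cases h : n 0 = 0 ∧ n 1 = 0
    · refine Or.inr (lineOf_eq_Nline hxy h fun h2 => hn ?_)
      ext i
      fin_cases i <;> simp [*]
    · obtain ⟨a, b, hab⟩ : ∃ a b, n 0 * a + n 1 * b + n 2 = 0 := by
        by_cases h0 : n 0 = 0
        · have h1 : n 1 ≠ 0 := fun h1 => h ⟨h0, h1⟩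
          exact ⟨0, -n 2 / n 1, by field_simp; ring⟩
        · exact ⟨-n 2 / n 0, 0, by field_simp; ring⟩
      refine Or.inl ⟨⟨_, _, lowerTri_of _ _ _, lowerTri_of _ _ _,
        isFreePair_of hxy (by rw [neg_ne_zero]; tauto) a b, lineOf_eq_cyc h hab⟩, a, b, ?_⟩
      have hM : Mpt x y a b = pointOf x y ![a, b, 1] := by simp [pointOf, Mpt]
      rw [hM, pointOf_subset_lineOf hxy]
      simp only [dotProduct, Fin.sum_univ_three]
      simp
      linear_combination hab

end Coordinates

section Projective

variable {F : Type} [Field F]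

/-- The point of the plane that corresponds to a point of `ℙ F (Fin 3 → F)`. -/
noncomputable def projPoint (x y : F) (p : ℙ F (Fin 3 → F)) : Set (Mat 2 F × Mat 2 F) :=
  pointOf x y p.rep

/-- The line of the plane that corresponds to a line of `ℙ F (Fin 3 → F)`. -/
noncomputable def projLine [DecidableEq F] (x y : F) (l : ℙ F (Fin 3 → F)) :
    Set (Mat 2 F × Mat 2 F) :=
  lineOf x y l.rep

lemma projPoint_mk (x y : F) {v : Fin 3 → F} (hv : v ≠ 0) :
    projPoint x y (.mk F v hv) = pointOf x y v := by
  obtain ⟨c, hc⟩ := Projectivization.exists_smul_eq_mk_rep F v hv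
  rw [projPoint, ← hc]
  exact pointOf_smul x y c.ne_zero v

lemma projLine_mk [DecidableEq F] (x y : F) {n : Fin 3 → F} (hn : n ≠ 0) :
    projLine x y (.mk F n hn) = lineOf x y n := by
  obtain ⟨c, hc⟩ := Projectivization.exists_smul_eq_mk_rep F n hn
  rw [projLine, ← hc]
  exact lineOf_smul x y c.ne_zero n

lemma range_projPoint (x y : F) : Set.range (projPoint x y) = PtSet x y := by
  rw [ptSet_eq]
  ext P
  constructor
  · rintro ⟨p, rfl⟩
    exact ⟨_, p.rep_nonzero, rfl⟩
  · rintro ⟨v, hv, rfl⟩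
    exact ⟨_, projPoint_mk x y hv⟩

lemma projPoint_injective {x y : F} (hxy : x ≠ 0 ∨ y ≠ 0) :
    Function.Injective (projPoint x y) := by
  intro p q h
  rw [← p.mk_rep, ← q.mk_rep, Projectivization.mk_eq_mk_iff']
  exact exists_smul_eq_of_pointOf_eq hxy h

variable [DecidableEq F]

lemma range_projLine {x y : F} (hxy : x ≠ 0 ∨ y ≠ 0) :
    Set.range (projLine x y) = LnSet x y := by
  rw [lnSet_eq hxy]
  ext l
  constructor
  · rintro ⟨n, rfl⟩
    exact ⟨_, n.rep_nonzero, rfl⟩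
  · rintro ⟨n, hn, rfl⟩
    exact ⟨_, projLine_mk x y hn⟩

lemma projPoint_subset_projLine {x y : F} (hxy : x ≠ 0 ∨ y ≠ 0) (p l : ℙ F (Fin 3 → F)) :
    projPoint x y p ⊆ projLine x y l ↔ p ∈ l := by
  rw [projPoint, projLine, pointOf_subset_lineOf hxy, ofField.mem_iff]
  conv_rhs => rw [← p.mk_rep, ← l.mk_rep, Projectivization.orthogonal_mk]

lemma order_projectivization [Fintype F] :
    ProjectivePlane.order (ℙ F (Fin 3 → F)) (ℙ F (Fin 3 → F)) = Fintype.card F := by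
  have := Fintype.ofFinite (ℙ F (Fin 3 → F))
  have h := ProjectivePlane.card_points (ℙ F (Fin 3 → F)) (ℙ F (Fin 3 → F))
  rw [← Nat.card_eq_fintype_card, Projectivization.card_of_finrank F (Fin 3 → F) (n := 3) (by simp),
    Nat.card_eq_fintype_card] at h
  simp only [Finset.sum_range_succ, Finset.sum_range_zero] at h
  nlinarith

lemma ncard_points_projLine [Fintype F] {x y : F} (hxy : x ≠ 0 ∨ y ≠ 0) (l : ℙ F (Fin 3 → F)) :
    Set.ncard {P ∈ PtSet x y | P ⊆ projLine x y l} = Fintype.card F + 1 := by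
  have h : {P ∈ PtSet x y | P ⊆ projLine x y l} = projPoint x y '' {p | p ∈ l} := by
    ext P
    rw [← range_projPoint]
    constructor
    · rintro ⟨⟨p, rfl⟩, hp⟩
      exact ⟨p, (projPoint_subset_projLine hxy p l).1 hp, rfl⟩
    · rintro ⟨p, hp, rfl⟩
      exact ⟨⟨p, rfl⟩, (projPoint_subset_projLine hxy p l).2 hp⟩
  rw [h, Set.ncard_image_of_injective _ (projPoint_injective hxy), ← order_projectivization,
    ← ProjectivePlane.pointCount_eq _ l]
  rfl

lemma exists_quadrangle (F : Type) [Field F] : ∃ p : Fin 4 → ℙ F (Fin 3 → F),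
    Function.Injective p ∧ ∀ i j k, i ≠ j → i ≠ k → j ≠ k →
      ∀ l : ℙ F (Fin 3 → F), ¬(p i ∈ l ∧ p j ∈ l ∧ p k ∈ l) := by
  let v : Fin 4 → Fin 3 → F := ![![1, 0, 0], ![0, 1, 0], ![0, 0, 1], ![1, 1, 1]]
  have hv : ∀ i, v i ≠ 0 := by
    intro i h
    have h0 := congr_fun h 0
    have h1 := congr_fun h 1
    have h2 := congr_fun h 2
    fin_cases i <;> simp [v] at h0 h1 h2
  refine ⟨fun i => .mk F (v i) (hv i), ?_, ?_⟩
  · intro i j h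
    obtain ⟨c, hc⟩ := (Projectivization.mk_eq_mk_iff' F _ _ _ _).1 h
    have h0 := congr_fun hc 0
    have h1 := congr_fun hc 1
    have h2 := congr_fun hc 2
    fin_cases i <;> fin_cases j <;> simp [v] at h0 h1 h2 ⊢ <;> simp_all
  · intro i j k hij hik hjk l
    induction l using Projectivization.ind with | h n hn =>
    simp only [ofField.mem_iff, Projectivization.orthogonal_mk, dotProduct, Fin.sum_univ_three]
    rintro ⟨h1, h2, h3⟩
    have : n 0 = 0 ∧ n 1 = 0 ∧ n 2 = 0 := by
      fin_cases i <;> fin_cases j <;> fin_cases k <;>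
        simp [v] at hij hik hjk h1 h2 h3 ⊢ <;> simp_all
    refine hn ?_
    ext i
    fin_cases i <;> simp [this]

end Projective

theorem stmt_12 (q : ℕ) (hq : 2 ≤ q)
    (F : Type) [Field F] [Fintype F] [DecidableEq F] (hF : Fintype.card F = q)
    (x22 y22 : F) (hxy : (x22, y22) ≠ (0, 0)) :
    -- two distinct points lie on a unique line
    (∀ P ∈ PtSet x22 y22, ∀ Q ∈ PtSet x22 y22, P ≠ Q →
      ∃! l : Set (Mat 2 F × Mat 2 F), l ∈ LnSet x22 y22 ∧ P ⊆ l ∧ Q ⊆ l) ∧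
    -- two distinct lines meet in a unique point
    (∀ l ∈ LnSet x22 y22, ∀ m ∈ LnSet x22 y22, l ≠ m →
      ∃! P : Set (Mat 2 F × Mat 2 F), P ∈ PtSet x22 y22 ∧ P ⊆ l ∧ P ⊆ m) ∧
    -- there are four points no three of which are collinear
    (∃ P₁ P₂ P₃ P₄ : Set (Mat 2 F × Mat 2 F),
      P₁ ∈ PtSet x22 y22 ∧ P₂ ∈ PtSet x22 y22 ∧
      P₃ ∈ PtSet x22 y22 ∧ P₄ ∈ PtSet x22 y22 ∧
      P₁ ≠ P₂ ∧ P₁ ≠ P₃ ∧ P₁ ≠ P₄ ∧ P₂ ≠ P₃ ∧ P₂ ≠ P₄ ∧ P₃ ≠ P₄ ∧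
      ∀ l ∈ LnSet x22 y22,
        ¬ (P₁ ⊆ l ∧ P₂ ⊆ l ∧ P₃ ⊆ l) ∧ ¬ (P₁ ⊆ l ∧ P₂ ⊆ l ∧ P₄ ⊆ l) ∧
        ¬ (P₁ ⊆ l ∧ P₃ ⊆ l ∧ P₄ ⊆ l) ∧ ¬ (P₂ ⊆ l ∧ P₃ ⊆ l ∧ P₄ ⊆ l)) ∧
    -- every line carries exactly q+1 points
    (∀ l ∈ LnSet x22 y22,
      Set.ncard {P ∈ PtSet x22 y22 | P ⊆ l} = q + 1) := by
  replace hxy : x22 ≠ 0 ∨ y22 ≠ 0 := by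
    by_contra! h
    exact hxy (Prod.ext h.1 h.2)
  simp only [← range_projPoint, ← range_projLine hxy]
  refine ⟨?_, ?_, ?_, ?_⟩
  · rintro _ ⟨p, rfl⟩ _ ⟨p', rfl⟩ hne
    obtain ⟨l, hl, huniq⟩ := HasLines.existsUnique_line _ (ℙ F (Fin 3 → F)) p p'
      (ne_of_apply_ne _ hne)
    refine ⟨projLine x22 y22 l, ⟨⟨l, rfl⟩, ?_⟩, ?_⟩
    · simpa only [projPoint_subset_projLine hxy] using hl
    · rintro _ ⟨⟨m, rfl⟩, hm⟩
      rw [huniq m (by simpa only [projPoint_subset_projLine hxy] using hm)]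
  · rintro _ ⟨l, rfl⟩ _ ⟨m, rfl⟩ hne
    obtain ⟨p, hp, huniq⟩ := HasPoints.existsUnique_point (ℙ F (Fin 3 → F)) _ l m
      (ne_of_apply_ne _ hne)
    refine ⟨projPoint x22 y22 p, ⟨⟨p, rfl⟩, ?_⟩, ?_⟩
    · simpa only [projPoint_subset_projLine hxy] using hp
    · rintro _ ⟨⟨p', rfl⟩, hp'⟩
      rw [huniq p' (by simpa only [projPoint_subset_projLine hxy] using hp')]
  · obtain ⟨p, hinj, hp⟩ := exists_quadrangle F
    have hne : ∀ i j, i ≠ j → projPoint x22 y22 (p i) ≠ projPoint x22 y22 (p j) := fun i j hij =>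
      ((projPoint_injective hxy).comp hinj).ne hij
    refine ⟨_, _, _, _, ⟨p 0, rfl⟩, ⟨p 1, rfl⟩, ⟨p 2, rfl⟩, ⟨p 3, rfl⟩,
      hne _ _ (by decide), hne _ _ (by decide), hne _ _ (by decide), hne _ _ (by decide),
      hne _ _ (by decide), hne _ _ (by decide), ?_⟩
    rintro _ ⟨l, rfl⟩
    simp only [projPoint_subset_projLine hxy]
    exact ⟨hp _ _ _ (by decide) (by decide) (by decide) l,
      hp _ _ _ (by decide) (by decide) (by decide) l,
      hp _ _ _ (by decide) (by decide) (by decide) l,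
      hp _ _ _ (by decide) (by decide) (by decide) l⟩
  · rintro _ ⟨l, rfl⟩
    rw [range_projPoint, ncard_points_projLine hxy, hF]
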